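/- arXiv:2410.09348 — 2 statements merged into one kernel-verified Lean document; each statement's English description precedes it below -/
import Mathlib

section
/- Let V be a finite set, let i and j be two distinct elements not in V, let k ≥ 1 be a natural number, let τ ≥ 0 be a real number, and let U, Û be real-valued functions on finite subsets of V ∪ {i,j} (a noiseless and a noisy utility function). For S ⊆ V write W(S) = U(S ∪ {i}) − U(S ∪ {j}) and Ŵ(S) = Û(S ∪ {i}) − Û(S ∪ {j}), and let N = ∑_{m=1}^{k−1} binom(|V|, m−1), which is the number of subsets S ⊆ V with |S| ≤ k−2. Assume: (i) for every m with 1 ≤ m ≤ k−1, the sum of W(S) over all S ⊆ V with |S| = m−1 is at least τ·binom(|V|, m−1) (i.e. the size-stratified averages of W are all at least τ); and (ii) ∑_{S ⊆ V, |S| ≤ k−2} (Ŵ(S) − W(S))² ≤ τ²·N. Then ( ∑_{S ⊆ V, |S| ≤ k−2} W(S) ) · ( ∑_{S ⊆ V, |S| ≤ k−2} Ŵ(S) ) ≥ 0; that is, the Banzhaf-value difference between i and j computed from the noisy utility has the same sign as the one computed from the true utility. -/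
open Finset

theorem sum_powerset_filter_card_le {α : Type*} (V : Finset α) (K : ℕ) (f : Finset α → ℝ) :
    ∑ S ∈ V.powerset.filter (fun S => S.card ≤ K), f S
      = ∑ m ∈ Finset.Icc 1 (K + 1), ∑ S ∈ V.powerset.filter (fun S => S.card = m - 1), f S := by
  rw [← Finset.sum_fiberwise_of_maps_to (g := fun S => S.card + 1) (t := Finset.Icc 1 (K + 1))]
  · refine Finset.sum_congr rfl fun m hm => Finset.sum_congr ?_ fun _ _ => rfl
    ext S
    simp only [Finset.mem_filter, Finset.mem_Icc] at hm ⊢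
    grind
  · intro S hS
    simp only [Finset.mem_filter, Finset.mem_Icc] at hS ⊢
    omega

theorem card_powerset_filter_card_le {α : Type*} (V : Finset α) (K : ℕ) :
    ((V.powerset.filter (fun S => S.card ≤ K)).card : ℝ)
      = ∑ m ∈ Finset.Icc 1 (K + 1), (V.card.choose (m - 1) : ℝ) := by
  have h := sum_powerset_filter_card_le V K fun _ => 1
  simpa only [Finset.sum_const, nsmul_eq_mul, mul_one, ← Finset.powersetCard_eq_filter,
    Finset.card_powersetCard] using h

/-- Robustness of the Banzhaf-value comparison between two players `i` and `j`
under a noisy utility function: if the size-stratified average distinguishability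
of the true utility is at least `τ` and the (squared) perturbation of the utility
differences is at most `τ² · N`, then the Banzhaf-value difference computed from
the noisy utility has the same sign as the one computed from the true utility. -/
theorem banzhaf_rank_robust {α : Type*} [DecidableEq α]
    (V : Finset α) (i j : α) (hij : i ≠ j) (hiV : i ∉ V) (hjV : j ∉ V)
    (k : ℕ) (hk : 1 ≤ k) (τ : ℝ) (hτ : 0 ≤ τ)
    (U Uhat : Finset α → ℝ)
    (W What : Finset α → ℝ)
    (hW : ∀ S, W S = U (insert i S) - U (insert j S))
    (hWhat : ∀ S, What S = Uhat (insert i S) - Uhat (insert j S))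
    (N : ℝ) (hN : N = ∑ m ∈ Finset.Icc 1 (k - 1), (V.card.choose (m - 1) : ℝ))
    (h1 : ∀ m, 1 ≤ m → m ≤ k - 1 →
      τ * (V.card.choose (m - 1) : ℝ)
        ≤ ∑ S ∈ V.powerset.filter (fun S => S.card = m - 1), W S)
    (h2 : ∑ S ∈ V.powerset.filter (fun S => S.card ≤ k - 2), (What S - W S) ^ 2
        ≤ τ ^ 2 * N) :
    0 ≤ (∑ S ∈ V.powerset.filter (fun S => S.card ≤ k - 2), W S)
        * (∑ S ∈ V.powerset.filter (fun S => S.card ≤ k - 2), What S) := by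
  obtain rfl | hk2 : k = 1 ∨ 2 ≤ k := by omega
  · have hsum : ∑ S ∈ V.powerset.filter (fun S => S.card ≤ 1 - 2), (What S - W S) ^ 2 = 0 :=
      le_antisymm (by simpa [hN] using h2) (Finset.sum_nonneg fun _ _ => sq_nonneg _)
    rw [Finset.sum_eq_zero_iff_of_nonneg fun _ _ => sq_nonneg _] at hsum
    rw [Finset.sum_congr rfl fun S hS => sub_eq_zero.mp (pow_eq_zero_iff two_ne_zero |>.mp
      (hsum S hS))]
    exact mul_self_nonneg _
  · obtain ⟨K, rfl⟩ := Nat.exists_eq_add_of_le' hk2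
    simp only [Nat.add_sub_cancel, show K + 2 - 1 = K + 1 by omega] at *
    have hcard := (card_powerset_filter_card_le V K).trans hN.symm
    have hN0 : 0 ≤ N := hcard ▸ Nat.cast_nonneg _
    have hWN : τ * N ≤ ∑ S ∈ V.powerset.filter (fun S => S.card ≤ K), W S := by
      rw [sum_powerset_filter_card_le, hN, Finset.mul_sum]
      refine Finset.sum_le_sum fun m hm => ?_
      rw [Finset.mem_Icc] at hm
      exact h1 m hm.1 hm.2
    have hdiff : |∑ S ∈ V.powerset.filter (fun S => S.card ≤ K), (What S - W S)| ≤ τ * N := by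
      refine abs_le_of_sq_le_sq ?_ (by positivity)
      calc _ ≤ N * ∑ S ∈ V.powerset.filter (fun S => S.card ≤ K), (What S - W S) ^ 2 :=
            hcard ▸ sq_sum_le_card_mul_sum_sq
        _ ≤ N * (τ ^ 2 * N) := mul_le_mul_of_nonneg_left h2 hN0
        _ = (τ * N) ^ 2 := by ring
    rw [Finset.sum_sub_distrib] at hdiff
    have hτN : 0 ≤ τ * N := mul_nonneg hτ hN0
    exact mul_nonneg (hτN.trans hWN) (by linarith [neg_le_of_abs_le hdiff])
end

section
/- Let ι be a finite type, let φ, φ̂ : ι → ℝ be two scoring functions (true and estimated Banzhaf values), and let T ⊆ ι be a subset of cardinality k. Assume: (i) φ strictly separates T from its complement, i.e. φ(i) > φ(j) for every i ∈ T and j ∉ T; and (ii) the pairwise rankings are sign-preserved across the two scorings, i.e. (φ̂(i) − φ̂(j)) · (φ(i) − φ(j)) ≥ 0 for every i ∈ T and j ∉ T. Then T maximizes the total estimated score among all subsets of cardinality k: for every S ⊆ ι with |S| = k, ∑_{i ∈ T} φ̂(i) ≥ ∑_{i ∈ S} φ̂(i). In particular, a top-k set under the true scores remains a top-k set under the estimated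 scores. -/
open Finset

/-- If every value of `f` on `T` dominates every value of `f` off `T`, then `T` maximizes the sum
of `f` among all finsets of the same cardinality. -/
theorem sum_le_sum_of_card_eq_of_forall_notMem_le {ι : Type*} [DecidableEq ι] (f : ι → ℝ)
    {S T : Finset ι} (hcard : S.card = T.card) (hf : ∀ i ∈ T, ∀ j ∉ T, f j ≤ f i) :
    ∑ i ∈ S, f i ≤ ∑ i ∈ T, f i := by
  have hsdiff : (S \ T).card = (T \ S).card := card_sdiff_comm hcard
  rw [← sum_sdiff_le_sum_sdiff]
  rcases (T \ S).eq_empty_or_nonempty with hempty | hne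
  · rw [hempty, card_empty, card_eq_zero] at hsdiff
    rw [hempty, hsdiff]
  · obtain ⟨m, hm, hmin⟩ := exists_min_image (T \ S) f hne
    calc ∑ i ∈ S \ T, f i ≤ (S \ T).card • f m :=
          sum_le_card_nsmul _ _ _ fun j hj =>
            hf m (mem_sdiff.mp hm).1 j (mem_sdiff.mp hj).2
      _ = (T \ S).card • f m := by rw [hsdiff]
      _ ≤ ∑ i ∈ T \ S, f i := card_nsmul_le_sum _ _ _ hmin

/-- If the true scores `φ` strictly separate a size-`k` set `T` from its
complement, and the pairwise rankings between members and non-members of `T`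
are sign-preserved by the estimated scores `φ̂`, then `T` maximizes the total
estimated score among all size-`k` subsets. -/
theorem topk_preserved {ι : Type*} [Fintype ι] [DecidableEq ι]
    (φ φhat : ι → ℝ) (T : Finset ι) (k : ℕ) (hT : T.card = k)
    (hsep : ∀ i ∈ T, ∀ j ∉ T, φ j < φ i)
    (hsign : ∀ i ∈ T, ∀ j ∉ T, 0 ≤ (φhat i - φhat j) * (φ i - φ j)) :
    ∀ S : Finset ι, S.card = k → ∑ i ∈ S, φhat i ≤ ∑ i ∈ T, φhat i := by
  intro S hS
  refine sum_le_sum_of_card_eq_of_forall_notMem_le φhat (hS.trans hT.symm) fun i hi j hj => ?_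
  exact sub_nonneg.mp (nonneg_of_mul_nonneg_left (hsign i hi j hj) (sub_pos.mpr (hsep i hi j hj)))
end
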